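/- arXiv:1711.09039 — 6 statements merged into one kernel-verified Lean document; each statement's English description precedes it below -/
import Mathlib

section
/- Let U and V be independent random variables, each distributed as the sum of squares of k independent standard Gaussian random variables. Then for every x > 0: Pr[ U/(U+V) ≥ (k + 2√(kx) + 2x)/(2(k+x)) ] ≤ 2e^{−x} and Pr[ U/(U+V) ≤ (k − 2√(kx))/(2(k+x)) ] ≤ 2e^{−x}. -/
open MeasureTheory ProbabilityTheory

/-- The law of a `χ²` statistic with `k` degrees of freedom: the distribution
of the sum of squares of `k` independent standard Gaussian random variables. -/
noncomputable def chiSqLaw (k : ℕ) : Measure ℝ :=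
  Measure.map (fun z : Fin k → ℝ => ∑ i, (z i) ^ 2)
    (Measure.pi fun _ : Fin k => gaussianReal 0 1)

namespace ChiSq

lemma gaussianPDFReal_mul_exp_mul_sq (t z : ℝ) :
    gaussianPDFReal 0 1 z * Real.exp (t * z ^ 2)
      = (√(2 * Real.pi))⁻¹ * Real.exp (-(1 / 2 - t) * z ^ 2) := by
  rw [gaussianPDFReal, mul_assoc, ← Real.exp_add]
  simp only [NNReal.coe_one, mul_one, sub_zero]
  congr 2
  ring

lemma integrable_exp_mul_sq_gaussianReal {t : ℝ} (ht : t < 1 / 2) :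
    Integrable (fun z => Real.exp (t * z ^ 2)) (gaussianReal 0 1) := by
  rw [gaussianReal_of_var_ne_zero _ one_ne_zero,
    integrable_withDensity_iff (measurable_gaussianPDF 0 1)
      (ae_of_all _ fun _ => gaussianPDF_lt_top)]
  simp_rw [toReal_gaussianPDF, mul_comm (Real.exp _), gaussianPDFReal_mul_exp_mul_sq]
  exact (integrable_exp_neg_mul_sq (by linarith)).const_mul _

lemma integral_exp_mul_sq_gaussianReal {t : ℝ} (ht : t < 1 / 2) :
    ∫ z, Real.exp (t * z ^ 2) ∂(gaussianReal 0 1) = √((1 - 2 * t)⁻¹) := by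
  rw [integral_gaussianReal_eq_integral_smul one_ne_zero]
  simp_rw [smul_eq_mul, gaussianPDFReal_mul_exp_mul_sq]
  rw [integral_const_mul, integral_gaussian, ← Real.sqrt_inv,
    ← Real.sqrt_mul (by positivity)]
  congr 1
  have h₁ : (1 / 2 - t) ≠ 0 := by linarith
  have h₂ : (1 - 2 * t) ≠ 0 := by linarith
  have h₃ := Real.pi_ne_zero
  field_simp

lemma measurable_sum_sq (k : ℕ) : Measurable fun z : Fin k → ℝ => ∑ i, (z i) ^ 2 := by
  fun_prop

instance isProbabilityMeasure_chiSqLaw (k : ℕ) : IsProbabilityMeasure (chiSqLaw k) :=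
  Measure.isProbabilityMeasure_map (measurable_sum_sq k).aemeasurable

lemma integrable_exp_mul_chiSqLaw (k : ℕ) {t : ℝ} (ht : t < 1 / 2) :
    Integrable (fun u => Real.exp (t * id u)) (chiSqLaw k) := by
  rw [chiSqLaw, integrable_map_measure (by fun_prop) (measurable_sum_sq k).aemeasurable]
  simp only [Function.comp_def, id, Finset.mul_sum, Real.exp_sum]
  exact Integrable.fintype_prod fun _ => integrable_exp_mul_sq_gaussianReal ht

/-- The moment generating function of the `χ²` law. -/
lemma mgf_chiSqLaw (k : ℕ) {t : ℝ} (ht : t < 1 / 2) :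
    mgf id (chiSqLaw k) t = √((1 - 2 * t)⁻¹) ^ k := by
  rw [mgf, chiSqLaw, integral_map (measurable_sum_sq k).aemeasurable (by fun_prop)]
  simp only [id, Finset.mul_sum, Real.exp_sum]
  rw [integral_fintype_prod_eq_pow (fun z : ℝ => Real.exp (t * z ^ 2)),
    integral_exp_mul_sq_gaussianReal ht, Fintype.card_fin]

lemma mgf_chiSqLaw_le (k : ℕ) {t c : ℝ} (ht : t < 1 / 2)
    (h : (1 - 2 * t)⁻¹ ≤ Real.exp (2 * c)) :
    mgf id (chiSqLaw k) t ≤ Real.exp (k * c) := by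
  rw [mgf_chiSqLaw k ht, Real.exp_nat_mul]
  gcongr
  rw [Real.sqrt_le_left (Real.exp_nonneg _), ← Real.exp_nat_mul]
  exact_mod_cast h

lemma inv_one_sub_le_exp {w : ℝ} (h₀ : 0 ≤ w) (h₁ : w < 1) :
    (1 - w)⁻¹ ≤ Real.exp (w + w ^ 2 / (2 * (1 - w))) := by
  have hw : 0 < 1 - w := by linarith
  have hlog : 0 ≤ Real.log (1 - w)⁻¹ := Real.log_nonneg (one_le_inv_iff₀.2 ⟨hw, by linarith⟩)
  rw [← Real.log_le_iff_le_exp (by positivity)]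
  calc Real.log (1 - w)⁻¹ ≤ Real.sinh (Real.log (1 - w)⁻¹) := Real.self_le_sinh_iff.2 hlog
    _ = w + w ^ 2 / (2 * (1 - w)) := by
      rw [Real.sinh_log (by positivity)]
      field_simp
      ring

lemma inv_one_add_le_exp {w : ℝ} (h₀ : 0 ≤ w) :
    (1 + w)⁻¹ ≤ Real.exp (-w + w ^ 2 / 2) := by
  rw [← Real.log_le_iff_le_exp (by positivity), Real.log_inv]
  have h : w - w ^ 2 / 2 ≤ 2 * w / (w + 2) := by
    rw [le_div_iff₀ (by positivity)]
    nlinarith [pow_nonneg h₀ 3]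
  linarith [Real.le_log_one_add_of_nonneg h₀]

/-- The Laurent–Massart upper tail bound. -/
lemma chiSqLaw_upper_tail {k : ℕ} (hk : 0 < k) {x : ℝ} (hx : 0 ≤ x) :
    (chiSqLaw k).real {u | (k : ℝ) + 2 * √(k * x) + 2 * x ≤ u} ≤ Real.exp (-x) := by
  rw [Real.sqrt_mul (Nat.cast_nonneg k)]
  have hn : 0 < √(k : ℝ) := Real.sqrt_pos.2 (by exact_mod_cast hk)
  have hy : 0 ≤ √x := Real.sqrt_nonneg x
  have hkn : (k : ℝ) = √(k : ℝ) ^ 2 := (Real.sq_sqrt (Nat.cast_nonneg k)).symm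
  have hxy : x = √x ^ 2 := (Real.sq_sqrt hx).symm
  generalize √(k : ℝ) = n at *
  generalize √x = y at *
  have hny : 0 < n + 2 * y := by positivity
  set t : ℝ := y / (n + 2 * y) with ht_def
  have ht₀ : 0 ≤ t := by positivity
  have h_one_sub : 1 - 2 * t = n / (n + 2 * y) := by
    rw [ht_def]
    field_simp
    ring
  have h_pos : 0 < 1 - 2 * t := h_one_sub ▸ by positivity
  have ht : t < 1 / 2 := by linarith
  have hmgf : mgf id (chiSqLaw k) t ≤ Real.exp (k * (t + t ^ 2 / (1 - 2 * t))) := by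
    refine mgf_chiSqLaw_le k ht ((inv_one_sub_le_exp (w := 2 * t) (by linarith)
      (by linarith)).trans_eq ?_)
    congr 1
    field_simp
  calc _ ≤ Real.exp (-t * (k + 2 * (n * y) + 2 * x)) * mgf id (chiSqLaw k) t :=
        measure_ge_le_exp_mul_mgf _ ht₀ (integrable_exp_mul_chiSqLaw k ht)
    _ ≤ Real.exp (-t * (k + 2 * (n * y) + 2 * x))
          * Real.exp (k * (t + t ^ 2 / (1 - 2 * t))) := by gcongr
    _ = Real.exp (-x) := by
      rw [← Real.exp_add, h_one_sub, ht_def, hkn, hxy]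
      congr 1
      field_simp
      ring

/-- The Laurent–Massart lower tail bound. -/
lemma chiSqLaw_lower_tail {k : ℕ} (hk : 0 < k) {x : ℝ} (hx : 0 ≤ x) :
    (chiSqLaw k).real {u | u ≤ (k : ℝ) - 2 * √(k * x)} ≤ Real.exp (-x) := by
  rw [Real.sqrt_mul (Nat.cast_nonneg k)]
  have hn : 0 < √(k : ℝ) := Real.sqrt_pos.2 (by exact_mod_cast hk)
  have hy : 0 ≤ √x := Real.sqrt_nonneg x
  have hkn : (k : ℝ) = √(k : ℝ) ^ 2 := (Real.sq_sqrt (Nat.cast_nonneg k)).symm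
  have hxy : x = √x ^ 2 := (Real.sq_sqrt hx).symm
  generalize √(k : ℝ) = n at *
  generalize √x = y at *
  set s : ℝ := y / n with hs_def
  have hs : 0 ≤ s := by positivity
  have ht : -s < 1 / 2 := by linarith
  have hmgf : mgf id (chiSqLaw k) (-s) ≤ Real.exp (k * (-s + s ^ 2)) := by
    refine mgf_chiSqLaw_le k ht ?_
    convert inv_one_add_le_exp (w := 2 * s) (by linarith) using 2 <;> ring
  calc _ ≤ Real.exp (-(-s) * (k - 2 * (n * y))) * mgf id (chiSqLaw k) (-s) :=
        measure_le_le_exp_mul_mgf _ (by linarith) (integrable_exp_mul_chiSqLaw k ht)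
    _ ≤ Real.exp (-(-s) * (k - 2 * (n * y))) * Real.exp (k * (-s + s ^ 2)) := by gcongr
    _ = Real.exp (-x) := by
      rw [← Real.exp_add, hs_def, hkn, hxy]
      congr 1
      field_simp
      ring

lemma ae_nonneg_chiSqLaw (k : ℕ) : ∀ᵐ u ∂(chiSqLaw k), 0 ≤ u := by
  rw [chiSqLaw, ae_map_iff (measurable_sum_sq k).aemeasurable measurableSet_Ici]
  exact ae_of_all _ fun z => Finset.sum_nonneg fun i _ => sq_nonneg (z i)

section RandomVariable

variable {Ω : Type*} [MeasurableSpace Ω] {μ : Measure Ω} {k : ℕ} {U V : Ω → ℝ} {x : ℝ}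

lemma ae_nonneg_of_map_eq (hU : Measurable U) (hUd : Measure.map U μ = chiSqLaw k) :
    ∀ᵐ ω ∂μ, 0 ≤ U ω :=
  ae_of_ae_map hU.aemeasurable (hUd ▸ ae_nonneg_chiSqLaw k)

lemma measure_upper_or_lower_le (hk : 0 < k) (hU : Measurable U) (hV : Measurable V)
    (hUd : Measure.map U μ = chiSqLaw k) (hVd : Measure.map V μ = chiSqLaw k) (hx : 0 ≤ x) :
    μ ({ω | (k : ℝ) + 2 * √(k * x) + 2 * x ≤ U ω} ∪ {ω | V ω ≤ (k : ℝ) - 2 * √(k * x)})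
      ≤ ENNReal.ofReal (2 * Real.exp (-x)) := by
  have h₁ : μ {ω | (k : ℝ) + 2 * √(k * x) + 2 * x ≤ U ω} ≤ ENNReal.ofReal (Real.exp (-x)) := by
    have h := Measure.map_apply (μ := μ) hU
      (measurableSet_Ici (a := (k : ℝ) + 2 * √(k * x) + 2 * x))
    rw [hUd] at h
    exact h.symm.trans_le
      ((ENNReal.le_ofReal_iff_toReal_le (measure_ne_top _ _) (Real.exp_nonneg _)).2
        (chiSqLaw_upper_tail hk hx))
  have h₂ : μ {ω | V ω ≤ (k : ℝ) - 2 * √(k * x)} ≤ ENNReal.ofReal (Real.exp (-x)) := by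
    have h := Measure.map_apply (μ := μ) hV
      (measurableSet_Iic (a := (k : ℝ) - 2 * √(k * x)))
    rw [hVd] at h
    exact h.symm.trans_le
      ((ENNReal.le_ofReal_iff_toReal_le (measure_ne_top _ _) (Real.exp_nonneg _)).2
        (chiSqLaw_lower_tail hk hx))
  rw [two_mul (Real.exp (-x)), ENNReal.ofReal_add (Real.exp_nonneg _) (Real.exp_nonneg _)]
  exact (measure_union_le _ _).trans (add_le_add h₁ h₂)

end RandomVariable

/-- If the ratio `u / (u + v)` is at least `a / (a + b)`, then `u` is large or `v` is small. -/
lemma le_or_le_of_le_div {u v a b : ℝ} (hu : 0 ≤ u) (hv : 0 ≤ v) (ha : 0 < a)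
    (hab : 0 < a + b) (h : a / (a + b) ≤ u / (u + v)) : a ≤ u ∨ v ≤ b := by
  by_contra! hc
  obtain ⟨hua, hbv⟩ := hc
  have hdiv : 0 < a / (a + b) := by positivity
  have huv : 0 < u + v := by
    rcases (add_nonneg hu hv).eq_or_lt with h0 | h0
    · rw [← h0, div_zero] at h
      linarith
    · exact h0
  rw [div_le_div_iff₀ hab huv] at h
  have hu' : 0 < u := by
    rcases hu.eq_or_lt with h0 | h0
    · rw [← h0] at h huv
      linarith [mul_pos ha huv]
    · exact h0
  nlinarith [mul_pos hu' (sub_pos.2 hbv), mul_nonneg hv (sub_pos.2 hua).le]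

/-- If the ratio `u / (u + v)` is at most `b / (a + b)`, then `v` is large or `u` is small. -/
lemma le_or_le_of_div_le {u v a b : ℝ} (hu : 0 ≤ u) (hv : 0 ≤ v)
    (hab : 0 < a + b) (h : u / (u + v) ≤ b / (a + b)) : a ≤ v ∨ u ≤ b := by
  by_contra! hc
  obtain ⟨hva, hbu⟩ := hc
  have hb : 0 ≤ b := by
    have h0 : 0 ≤ b / (a + b) := le_trans (by positivity) h
    by_contra! hneg
    linarith [div_neg_of_neg_of_pos hneg hab]
  have hu' : 0 < u := hb.trans_lt hbu
  rw [div_le_div_iff₀ (by linarith) hab] at h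
  nlinarith [mul_pos hu' (sub_pos.2 hva), mul_nonneg hv (sub_pos.2 hbu).le]

end ChiSq

/-- Tail bounds for the ratio `U/(U+V)` of two independent `χ²(k)` statistics. -/
theorem chiSq_ratio_tail_bounds
    {Ω : Type*} [MeasurableSpace Ω] (μ : Measure Ω) [IsProbabilityMeasure μ]
    (k : ℕ) (hk : 0 < k) (U V : Ω → ℝ)
    (hU : Measurable U) (hV : Measurable V)
    (hindep : IndepFun U V μ)
    (hUd : Measure.map U μ = chiSqLaw k) (hVd : Measure.map V μ = chiSqLaw k)
    (x : ℝ) (hx : 0 < x) :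
    μ {ω | U ω / (U ω + V ω)
        ≥ ((k : ℝ) + 2 * Real.sqrt (k * x) + 2 * x) / (2 * ((k : ℝ) + x))}
      ≤ ENNReal.ofReal (2 * Real.exp (-x)) ∧
    μ {ω | U ω / (U ω + V ω)
        ≤ ((k : ℝ) - 2 * Real.sqrt (k * x)) / (2 * ((k : ℝ) + x))}
      ≤ ENNReal.ofReal (2 * Real.exp (-x)) := by
  have hk' : (0 : ℝ) < k := by exact_mod_cast hk
  have hsum : 2 * ((k : ℝ) + x)
      = ((k : ℝ) + 2 * Real.sqrt (k * x) + 2 * x) + ((k : ℝ) - 2 * Real.sqrt (k * x)) := by ring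
  have hab : 0 < ((k : ℝ) + 2 * Real.sqrt (k * x) + 2 * x)
      + ((k : ℝ) - 2 * Real.sqrt (k * x)) := hsum ▸ by positivity
  have hU₀ := ChiSq.ae_nonneg_of_map_eq hU hUd
  have hV₀ := ChiSq.ae_nonneg_of_map_eq hV hVd
  rw [hsum]
  constructor
  · refine (measure_mono_ae ?_).trans (ChiSq.measure_upper_or_lower_le hk hU hV hUd hVd hx.le)
    filter_upwards [hU₀, hV₀] with ω hu hv h
    exact ChiSq.le_or_le_of_le_div hu hv (by positivity) hab h
  · refine (measure_mono_ae ?_).trans (ChiSq.measure_upper_or_lower_le hk hV hU hVd hUd hx.le)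
    filter_upwards [hU₀, hV₀] with ω hu hv h
    exact ChiSq.le_or_le_of_div_le hu hv hab h
end

section
/- Let x = (x₁, x₂) and y = (y₁, y₂) be vectors in ℝ^{2k} split into halves x₁, x₂, y₁, y₂ ∈ ℝ^k, and let t ∈ [0,1]. Assume the four bounds (1/2)(1 − (11/5)t)‖x+y‖² ≤ ‖x₁+y₁‖² ≤ (1/2)(1 + (5/2)t)‖x+y‖² and (1/2)(1 − (11/5)t)‖x−y‖² ≤ ‖x₁−y₁‖² ≤ (1/2)(1 + (5/2)t)‖x−y‖². Then ⟨x,y⟩ − (47/10)t(‖x‖² + ‖y‖²) ≤ 2⟨x₁,y₁⟩ ≤ ⟨x,y⟩ + (47/10)t(‖x‖² + ‖y‖²). -/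
/-- Squared Euclidean norm of a vector in `ℝ^m`. -/
def sqNorm {m : ℕ} (v : Fin m → ℝ) : ℝ := ∑ i, (v i) ^ 2

/-- Euclidean inner product on `ℝ^m`. -/
def innerR {m : ℕ} (u v : Fin m → ℝ) : ℝ := ∑ i, u i * v i

/-- First half of a vector in `ℝ^{2k}`. -/
def firstHalf {k : ℕ} (v : Fin (k + k) → ℝ) : Fin k → ℝ := fun i => v (Fin.castAdd k i)

theorem sqNorm_nonneg {m : ℕ} (v : Fin m → ℝ) : 0 ≤ sqNorm v :=
  Finset.sum_nonneg fun i _ => sq_nonneg (v i)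

theorem sqNorm_add {m : ℕ} (u v : Fin m → ℝ) :
    sqNorm (u + v) = sqNorm u + 2 * innerR u v + sqNorm v := by
  simp only [sqNorm, innerR, Finset.mul_sum, ← Finset.sum_add_distrib]
  refine Finset.sum_congr rfl fun i _ => ?_
  rw [Pi.add_apply]
  ring

theorem sqNorm_sub {m : ℕ} (u v : Fin m → ℝ) :
    sqNorm (u - v) = sqNorm u - 2 * innerR u v + sqNorm v := by
  simp only [sqNorm, innerR, Finset.mul_sum, ← Finset.sum_add_distrib, ← Finset.sum_sub_distrib]
  refine Finset.sum_congr rfl fun i _ => ?_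
  rw [Pi.sub_apply]
  ring

theorem firstHalf_add {k : ℕ} (u v : Fin (k + k) → ℝ) :
    firstHalf (u + v) = firstHalf u + firstHalf v := rfl

theorem firstHalf_sub {k : ℕ} (u v : Fin (k + k) → ℝ) :
    firstHalf (u - v) = firstHalf u - firstHalf v := rfl

/-- Deterministic polarization step in the proof of Lemma 3 (estXY): if the
squared norms of the first halves of `x + y` and `x - y` are pinched between
`(1/2)(1 ± c t)` times the full squared norms, then `2⟨x₁,y₁⟩` is within
`(47/10) t (‖x‖² + ‖y‖²)` of `⟨x,y⟩`. -/
theorem polarization_inner_product_bound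
    {k : ℕ} (x y : Fin (k + k) → ℝ) (t : ℝ) (ht0 : 0 ≤ t) (ht1 : t ≤ 1)
    (h1 : (1 / 2) * (1 - (11 / 5) * t) * sqNorm (x + y) ≤ sqNorm (firstHalf (x + y)))
    (h2 : sqNorm (firstHalf (x + y)) ≤ (1 / 2) * (1 + (5 / 2) * t) * sqNorm (x + y))
    (h3 : (1 / 2) * (1 - (11 / 5) * t) * sqNorm (x - y) ≤ sqNorm (firstHalf (x - y)))
    (h4 : sqNorm (firstHalf (x - y)) ≤ (1 / 2) * (1 + (5 / 2) * t) * sqNorm (x - y)) :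
    innerR x y - (47 / 10) * t * (sqNorm x + sqNorm y)
        ≤ 2 * innerR (firstHalf x) (firstHalf y) ∧
    2 * innerR (firstHalf x) (firstHalf y)
        ≤ innerR x y + (47 / 10) * t * (sqNorm x + sqNorm y) := by
  have hadd := mul_nonneg ht0 (sqNorm_nonneg (x + y))
  have hsub := mul_nonneg ht0 (sqNorm_nonneg (x - y))
  rw [firstHalf_add] at h1 h2
  rw [firstHalf_sub] at h3 h4
  rw [sqNorm_add] at hadd
  rw [sqNorm_sub] at hsub
  rw [sqNorm_add, sqNorm_add] at h1 h2
  rw [sqNorm_sub, sqNorm_sub] at h3 h4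
  constructor <;> linarith
end

section
/- Let X = (X₁, X₂) and Y = (Y₁, Y₂) be independent random vectors in ℝ^{2k}, each with i.i.d. centered Gaussian coordinates (of variances σ_X² > 0 and σ_Y² > 0 respectively), with X₁, Y₁ the first k coordinates. Then for every x with 0 < x ≤ k/2: Pr[ |2⟨X₁,Y₁⟩ − ⟨X,Y⟩| ≥ (47/10)√(x/k)(‖X‖² + ‖Y‖²) ] ≤ 8e^{−x}. -/
open MeasureTheory ProbabilityTheory

/-- The exponential moment of a quadratic polynomial under a centered Gaussian measure. -/
lemma lintegral_exp_quadratic_gaussianReal {v : NNReal} (hv : v ≠ 0) (b c : ℝ)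
    (hc : 0 < 1 + 2 * c * v) :
    ∫⁻ h, ENNReal.ofReal (Real.exp (b * h - c * h ^ 2)) ∂(gaussianReal 0 v)
      = ENNReal.ofReal ((Real.sqrt (1 + 2 * c * v))⁻¹
          * Real.exp (b ^ 2 * v / (2 * (1 + 2 * c * v)))) := by
  have hv0 : (0 : ℝ) < v := by positivity
  set A : ℝ := 1 + 2 * c * v with hA
  let w : NNReal := ⟨v / A, by positivity⟩
  have hwv : (w : ℝ) = v / A := rfl
  have hw : w ≠ 0 := by
    rw [← NNReal.coe_ne_zero, hwv]
    positivity
  rw [gaussianReal_of_var_ne_zero _ hv,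
    lintegral_withDensity_eq_lintegral_mul _ (measurable_gaussianPDF 0 v) (by fun_prop)]
  have key : ∀ h : ℝ, gaussianPDFReal 0 v h * Real.exp (b * h - c * h ^ 2)
      = ((Real.sqrt A)⁻¹ * Real.exp (b ^ 2 * v / (2 * A)))
        * gaussianPDFReal (b * w) w h := by
    intro h
    simp only [gaussianPDFReal, hwv]
    have hs : Real.sqrt (2 * Real.pi * v)
        = Real.sqrt A * Real.sqrt (2 * Real.pi * (v / A)) := by
      rw [← Real.sqrt_mul hc.le]
      congr 1
      field_simp
    rw [hs, mul_inv, mul_assoc, ← Real.exp_add]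
    have he : -(h - 0) ^ 2 / (2 * (v : ℝ)) + (b * h - c * h ^ 2)
        = b ^ 2 * v / (2 * A) + -(h - b * (v / A)) ^ 2 / (2 * (v / A)) := by
      have hc' : c = (A - 1) / (2 * v) := by
        rw [hA]
        field_simp
        ring
      rw [hc']
      field_simp
      ring
    rw [he, Real.exp_add]
    ring
  calc ∫⁻ h, (gaussianPDF 0 v * fun h => ENNReal.ofReal (Real.exp (b * h - c * h ^ 2))) h
      = ∫⁻ h, ENNReal.ofReal ((Real.sqrt A)⁻¹ * Real.exp (b ^ 2 * v / (2 * A)))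
          * gaussianPDF (b * w) w h := by
        refine lintegral_congr fun h => ?_
        rw [Pi.mul_apply, gaussianPDF, gaussianPDF,
          ← ENNReal.ofReal_mul (gaussianPDFReal_nonneg _ _ _), key,
          ENNReal.ofReal_mul (by positivity)]
    _ = _ := by
        rw [lintegral_const_mul _ (measurable_gaussianPDF _ _),
          lintegral_gaussianPDF_eq_one _ hw, mul_one]

/-- The exponential moment of a quadratic form in two independent centered Gaussians. -/
lemma lintegral_lintegral_exp_quadratic_gaussianReal {s t : NNReal} (hs : s ≠ 0) (ht : t ≠ 0)
    (b c : ℝ) (hc : 0 ≤ c) (hD : 0 < (1 + 2 * c * s) * (1 + 2 * c * t) - b ^ 2 * s * t) :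
    ∫⁻ g, ∫⁻ h, ENNReal.ofReal (Real.exp (b * (g * h) - c * (g ^ 2 + h ^ 2)))
        ∂(gaussianReal 0 t) ∂(gaussianReal 0 s)
      = ENNReal.ofReal
          (Real.sqrt ((1 + 2 * c * s) * (1 + 2 * c * t) - b ^ 2 * s * t))⁻¹ := by
  have hA : 0 < 1 + 2 * c * (t : ℝ) := by positivity
  set A : ℝ := 1 + 2 * c * t
  have hc' : 1 + 2 * (c - b ^ 2 * t / (2 * A)) * s
      = ((1 + 2 * c * s) * A - b ^ 2 * s * t) / A := by
    field_simp
    ring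
  calc ∫⁻ g, ∫⁻ h, ENNReal.ofReal (Real.exp (b * (g * h) - c * (g ^ 2 + h ^ 2)))
        ∂(gaussianReal 0 t) ∂(gaussianReal 0 s)
      = ∫⁻ g, ENNReal.ofReal (Real.sqrt A)⁻¹
          * ENNReal.ofReal (Real.exp (0 * g - (c - b ^ 2 * t / (2 * A)) * g ^ 2))
          ∂(gaussianReal 0 s) := by
        refine lintegral_congr fun g => ?_
        have hsplit : ∀ h : ℝ,
            ENNReal.ofReal (Real.exp (b * (g * h) - c * (g ^ 2 + h ^ 2)))
            = ENNReal.ofReal (Real.exp (-c * g ^ 2))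
              * ENNReal.ofReal (Real.exp ((b * g) * h - c * h ^ 2)) := by
          intro h
          rw [← ENNReal.ofReal_mul (Real.exp_nonneg _), ← Real.exp_add]
          congr 2
          ring
        simp_rw [hsplit]
        rw [lintegral_const_mul _ (by fun_prop),
          lintegral_exp_quadratic_gaussianReal ht _ _ hA,
          ← ENNReal.ofReal_mul (Real.exp_nonneg _), ← ENNReal.ofReal_mul (by positivity),
          mul_left_comm, ← Real.exp_add]
        congr 3
        ring
    _ = _ := by
        rw [lintegral_const_mul _ (by fun_prop),
          lintegral_exp_quadratic_gaussianReal hs _ _ (by rw [hc']; positivity), hc',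
          ← ENNReal.ofReal_mul (by positivity), ← mul_assoc, ← mul_inv,
          ← Real.sqrt_mul hA.le, mul_div_cancel₀ _ hA.ne']
        simp

/-- The integral of a product of functions of separate coordinates is the product of the
integrals. -/
lemma lintegral_pi_prod_eq_prod_lintegral {ι : Type*} [Fintype ι] {α : ι → Type*}
    [∀ i, MeasurableSpace (α i)] (ν : ∀ i, Measure (α i)) [∀ i, IsProbabilityMeasure (ν i)]
    (f : ∀ i, α i → ENNReal) (hf : ∀ i, Measurable (f i)) :
    ∫⁻ z, ∏ i, f i (z i) ∂(Measure.pi ν) = ∏ i, ∫⁻ a, f i a ∂(ν i) := by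
  refine (lintegral_prod_eq_prod_lintegral_of_indepFun Finset.univ
    (fun i (z : ∀ i, α i) => f i (z i)) (iIndepFun_pi fun i => (hf i).aemeasurable)
    fun i => (hf i).comp (measurable_pi_apply i)).trans ?_
  exact Finset.prod_congr rfl fun i _ =>
    (measurePreserving_eval ν i).lintegral_comp (hf i)

/-- Chernoff bound for a signed inner product of independent centered Gaussian vectors against
the sum of their squared norms. -/
lemma measure_signed_inner_ge_le {Ω : Type*} [MeasurableSpace Ω] {μ : Measure Ω}
    [IsProbabilityMeasure μ] {m : ℕ} {s t : NNReal} (hs : s ≠ 0) (ht : t ≠ 0)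
    {X Y : Ω → (Fin m → ℝ)} (hX : Measurable X) (hY : Measurable Y) (hindep : IndepFun X Y μ)
    (hXdist : Measure.map X μ = Measure.pi fun _ : Fin m => gaussianReal 0 s)
    (hYdist : Measure.map Y μ = Measure.pi fun _ : Fin m => gaussianReal 0 t)
    (e : Fin m → ℝ) (he : ∀ i, e i ^ 2 = 1) {a l : ℝ} (ha : 0 ≤ a) (hl : 0 ≤ l)
    (hD : 0 < (1 + 2 * (l * a) * s) * (1 + 2 * (l * a) * t) - l ^ 2 * s * t) :
    μ {ω | a * (sqNorm (X ω) + sqNorm (Y ω)) ≤ ∑ i, e i * (X ω i * Y ω i)}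
      ≤ ENNReal.ofReal
          (Real.sqrt ((1 + 2 * (l * a) * s) * (1 + 2 * (l * a) * t) - l ^ 2 * s * t))⁻¹ ^ m := by
  let φ : Fin m → ℝ → ℝ → ENNReal := fun i g h =>
    ENNReal.ofReal (Real.exp ((l * e i) * (g * h) - (l * a) * (g ^ 2 + h ^ 2)))
  have hφ : ∀ i, Measurable (Function.uncurry (φ i)) := fun i => by
    simp only [φ, Function.uncurry_def]
    fun_prop
  let F : (Fin m → ℝ) × (Fin m → ℝ) → ENNReal := fun p => ∏ i, φ i (p.1 i) (p.2 i)
  have hF : Measurable F := by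
    simp only [F, φ]
    fun_prop
  have hFexp : ∀ p, F p = ENNReal.ofReal
      (Real.exp (l * (∑ i, e i * (p.1 i * p.2 i) - a * (sqNorm p.1 + sqNorm p.2)))) := by
    intro p
    simp only [F, φ]
    rw [← ENNReal.ofReal_prod_of_nonneg fun i _ => Real.exp_nonneg _, ← Real.exp_sum]
    congr 2
    simp only [sqNorm]
    rw [← Finset.sum_add_distrib, Finset.mul_sum, ← Finset.sum_sub_distrib, Finset.mul_sum]
    exact Finset.sum_congr rfl fun i _ => by ring
  have hmarkov := mul_meas_ge_le_lintegral (μ := μ) (hF.comp (hX.prodMk hY)) 1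
  rw [one_mul] at hmarkov
  calc μ {ω | a * (sqNorm (X ω) + sqNorm (Y ω)) ≤ ∑ i, e i * (X ω i * Y ω i)}
      ≤ μ {ω | 1 ≤ (F ∘ fun ω => (X ω, Y ω)) ω} := by
        refine measure_mono fun ω hω => ?_
        simp only [Set.mem_ofPred_eq, Function.comp_apply, hFexp, ENNReal.one_le_ofReal,
          Real.one_le_exp_iff] at hω ⊢
        exact mul_nonneg hl (sub_nonneg.2 hω)
    _ ≤ ∫⁻ ω, (F ∘ fun ω => (X ω, Y ω)) ω ∂μ := hmarkov
    _ = ∫⁻ p, F p ∂((Measure.pi fun _ : Fin m => gaussianReal 0 s).prod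
          (Measure.pi fun _ : Fin m => gaussianReal 0 t)) := by
        rw [← hXdist, ← hYdist, ← hindep.map_prod_eq_prod_map_map hX.aemeasurable
          hY.aemeasurable, lintegral_map hF (hX.prodMk hY)]
        rfl
    _ = ∏ i, ∫⁻ g, ∫⁻ h, φ i g h ∂(gaussianReal 0 t) ∂(gaussianReal 0 s) := by
        rw [lintegral_prod _ hF.aemeasurable, ← lintegral_pi_prod_eq_prod_lintegral _
          (fun i g => ∫⁻ h, φ i g h ∂(gaussianReal 0 t))
          fun i => (hφ i).lintegral_prod_right']
        exact lintegral_congr fun u => lintegral_pi_prod_eq_prod_lintegral _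
          (fun i h => φ i (u i) h) fun i => (hφ i).comp measurable_prodMk_left
    _ = _ := by
        have hb : ∀ i, (l * e i) ^ 2 = l ^ 2 := fun i => by rw [mul_pow, he, mul_one]
        have hi : ∀ i, ∫⁻ g, ∫⁻ h, φ i g h ∂(gaussianReal 0 t) ∂(gaussianReal 0 s) = _ :=
          fun i => lintegral_lintegral_exp_quadratic_gaussianReal hs ht (l * e i) (l * a)
            (mul_nonneg hl ha) (by rw [hb]; exact hD)
        simp_rw [hi, hb]
        simp

/-- The Chernoff bound at the exponential scale: deviations of relative size `√(x / k)`. -/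
lemma measure_signed_inner_ge_le_exp {Ω : Type*} [MeasurableSpace Ω] {μ : Measure Ω}
    [IsProbabilityMeasure μ] {k : ℕ} (hk : 0 < k) {s t : NNReal} (hs : s ≠ 0) (ht : t ≠ 0)
    {X Y : Ω → (Fin (k + k) → ℝ)} (hX : Measurable X) (hY : Measurable Y)
    (hindep : IndepFun X Y μ)
    (hXdist : Measure.map X μ = Measure.pi fun _ : Fin (k + k) => gaussianReal 0 s)
    (hYdist : Measure.map Y μ = Measure.pi fun _ : Fin (k + k) => gaussianReal 0 t)
    (e : Fin (k + k) → ℝ) (he : ∀ i, e i ^ 2 = 1) {x : ℝ} (hx0 : 0 < x)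
    (hxk : x ≤ (k : ℝ) / 2) :
    μ {ω | (47 / 10) * Real.sqrt (x / k) * (sqNorm (X ω) + sqNorm (Y ω))
        ≤ ∑ i, e i * (X ω i * Y ω i)} ≤ ENNReal.ofReal (Real.exp (-x)) := by
  have hk0 : (0 : ℝ) < k := by exact_mod_cast hk
  have hs0 : (0 : ℝ) < s := by positivity
  have ht0 : (0 : ℝ) < t := by positivity
  set r : ℝ := Real.sqrt (x / k) with hr
  have hr0 : 0 < r := by positivity
  have hr2 : r ^ 2 = x / k := Real.sq_sqrt (by positivity)
  have hr2le : r ^ 2 ≤ 1 / 2 := by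
    rw [hr2, div_le_iff₀ hk0]
    linarith
  set q : ℝ := Real.sqrt (s * t) with hq
  have hq0 : 0 < q := by positivity
  have hq2 : q ^ 2 = s * t := Real.sq_sqrt (by positivity)
  have hst : 2 * q ≤ s + t := by
    refine abs_le_of_sq_le_sq' ?_ (by positivity) |>.2
    nlinarith [sq_nonneg ((s : ℝ) - t)]
  have hexp : Real.exp (r ^ 2) ≤ (1 + 2 * (r / q * (47 / 10 * r)) * s)
      * (1 + 2 * (r / q * (47 / 10 * r)) * t) - (r / q) ^ 2 * s * t := by
    have h1 : Real.exp (r ^ 2) ≤ 1 + 2 * r ^ 2 := by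
      have h2 := Real.one_sub_le_exp_neg (r ^ 2)
      rw [Real.exp_neg] at h2
      have h3 : (1 - r ^ 2) * Real.exp (r ^ 2) ≤ 1 := by
        calc (1 - r ^ 2) * Real.exp (r ^ 2)
            ≤ (Real.exp (r ^ 2))⁻¹ * Real.exp (r ^ 2) := by gcongr
          _ = 1 := inv_mul_cancel₀ (Real.exp_pos _).ne'
      nlinarith [Real.exp_pos (r ^ 2), sq_nonneg r]
    have h4 : (1 + 2 * (r / q * (47 / 10 * r)) * s) * (1 + 2 * (r / q * (47 / 10 * r)) * t)
        - (r / q) ^ 2 * s * t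
        = 1 + 47 / 5 * r ^ 2 * ((s + t) / q) + (47 / 5 * r ^ 2) ^ 2 * (s * t / q ^ 2)
          - r ^ 2 * (s * t / q ^ 2) := by
      field_simp
      ring
    rw [h4, ← hq2, div_self (by positivity)]
    have h5 : 2 ≤ (s + t) / q := by rwa [le_div_iff₀ hq0]
    nlinarith [mul_le_mul_of_nonneg_left h5 (sq_nonneg r), sq_nonneg (47 / 5 * r ^ 2)]
  refine (measure_signed_inner_ge_le hs ht hX hY hindep hXdist hYdist e he
    (a := 47 / 10 * r) (l := r / q) (by positivity) (by positivity)
    ((Real.exp_pos _).trans_le hexp)).trans ?_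
  rw [← ENNReal.ofReal_pow (by positivity)]
  refine ENNReal.ofReal_le_ofReal ?_
  calc _ ≤ (Real.sqrt (Real.exp (r ^ 2)))⁻¹ ^ (k + k) := by gcongr
    _ = (Real.exp (r ^ 2))⁻¹ ^ k := by
        rw [← two_mul, pow_mul, inv_pow, Real.sq_sqrt (Real.exp_nonneg _)]
    _ = Real.exp (-x) := by
        rw [← Real.exp_neg, ← Real.exp_nat_mul, hr2]
        congr 1
        field_simp

/-- The polarization gap as a signed inner product. -/
lemma two_mul_innerR_firstHalf_sub {k : ℕ} (u v : Fin (k + k) → ℝ) :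
    2 * innerR (firstHalf u) (firstHalf v) - innerR u v
      = ∑ i, (Fin.append (fun _ : Fin k => (1 : ℝ)) (fun _ : Fin k => -1) i) * (u i * v i) := by
  simp only [innerR, firstHalf, Fin.sum_univ_add, Fin.append_left, Fin.append_right, one_mul,
    neg_mul, Finset.sum_neg_distrib]
  ring

/-- Lemma 3 (estXY) of the paper: for independent random vectors
`X = (X₁,X₂)` and `Y = (Y₁,Y₂)` in `ℝ^{2k}` with i.i.d. centered Gaussian
coordinates of variances `σ_X² > 0` and `σ_Y² > 0`, the polarized inner
product `2⟨X₁,Y₁⟩` concentrates around `⟨X,Y⟩`. -/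
theorem estXY_inner_product_concentration
    {Ω : Type*} [MeasurableSpace Ω] (μ : Measure Ω) [IsProbabilityMeasure μ]
    (k : ℕ) (hk : 0 < k) (σX σY : ℝ) (hσX : 0 < σX ^ 2) (hσY : 0 < σY ^ 2)
    (X Y : Ω → (Fin (k + k) → ℝ))
    (hXmeas : Measurable X) (hYmeas : Measurable Y)
    (hindep : IndepFun X Y μ)
    (hXdist : Measure.map X μ = Measure.pi fun _ : Fin (k + k) => gaussianReal 0 ⟨σX ^ 2, hσX.le⟩)
    (hYdist : Measure.map Y μ = Measure.pi fun _ : Fin (k + k) => gaussianReal 0 ⟨σY ^ 2, hσY.le⟩)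
    (x : ℝ) (hx0 : 0 < x) (hxk : x ≤ (k : ℝ) / 2) :
    μ {ω | |2 * innerR (firstHalf (X ω)) (firstHalf (Y ω)) - innerR (X ω) (Y ω)|
        ≥ (47 / 10) * Real.sqrt (x / k) * (sqNorm (X ω) + sqNorm (Y ω))}
      ≤ ENNReal.ofReal (8 * Real.exp (-x)) := by
  have hs : (⟨σX ^ 2, hσX.le⟩ : NNReal) ≠ 0 := fun h => hσX.ne' (congrArg NNReal.toReal h)
  have ht : (⟨σY ^ 2, hσY.le⟩ : NNReal) ≠ 0 := fun h => hσY.ne' (congrArg NNReal.toReal h)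
  let e : Fin (k + k) → ℝ := Fin.append (fun _ : Fin k => (1 : ℝ)) (fun _ : Fin k => -1)
  have he : ∀ i, e i ^ 2 = 1 := fun i => by
    induction i using Fin.addCases <;>
      simp only [e, Fin.append_left, Fin.append_right, one_pow, even_two, Even.neg_pow]
  have hpos := measure_signed_inner_ge_le_exp hk hs ht hXmeas hYmeas hindep hXdist hYdist
    e he hx0 hxk
  have hneg := measure_signed_inner_ge_le_exp hk hs ht hXmeas hYmeas hindep hXdist hYdist
    (-e) (fun i => by simp [he]) hx0 hxk
  refine (measure_mono fun ω hω => ?_).trans ((measure_union_le _ _).trans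
    ((add_le_add hpos hneg).trans ?_))
  · simp only [Set.mem_ofPred_eq, two_mul_innerR_firstHalf_sub, ge_iff_le, le_abs] at hω
    refine hω.imp id fun h => ?_
    simpa only [Set.mem_ofPred_eq, Pi.neg_apply, neg_mul, Finset.sum_neg_distrib] using h
  · rw [← ENNReal.ofReal_add (Real.exp_nonneg _) (Real.exp_nonneg _)]
    exact ENNReal.ofReal_le_ofReal (by linarith [Real.exp_pos (-x)])
end

section
/- Let X = (X₁, X₂) and Y = (Y₁, Y₂) be independent random vectors in ℝ^{2k}, each with i.i.d. centered Gaussian coordinates, with X₁, Y₁ the first k coordinates and X₂, Y₂ the last k coordinates. Then for every x with 0 < x ≤ k/2: Pr[ |⟨X₁,Y₁⟩ − ⟨X₂,Y₂⟩| ≥ 5√(x/k)(‖X‖² + ‖Y‖²) ] ≤ 8e^{−x}. -/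
open MeasureTheory ProbabilityTheory

/-- Second half of a vector in `ℝ^{2k}`. -/
def secondHalf {k : ℕ} (v : Fin (k + k) → ℝ) : Fin k → ℝ := fun i => v (Fin.natAdd k i)

open scoped NNReal

theorem integral_exp_neg_sq_div_gaussianReal {v : ℝ≥0} (hv : v ≠ 0) :
    ∫ x, Real.exp (-(x ^ 2 / v)) ∂gaussianReal 0 v = √(1 / 3) := by
  have hv' : (0 : ℝ) < v := by positivity
  rw [integral_gaussianReal_eq_integral_smul hv]
  have h (x : ℝ) : gaussianPDFReal 0 v x • Real.exp (-(x ^ 2 / v))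
      = (√(2 * Real.pi * v))⁻¹ * Real.exp (-(3 / (2 * v)) * x ^ 2) := by
    rw [gaussianPDFReal, smul_eq_mul, mul_assoc, ← Real.exp_add]
    congr 2
    field_simp
    ring
  simp_rw [h]
  rw [integral_const_mul, integral_gaussian, ← Real.sqrt_inv, ← Real.sqrt_mul (by positivity)]
  congr 1
  field_simp

/-- Lower tail bound for the squared norm of a vector with i.i.d. centered Gaussian coordinates. -/
theorem measureReal_pi_gaussianReal_sum_sq_le {ι : Type*} [Fintype ι] {v : ℝ≥0} (hv : v ≠ 0)
    (s : ℝ) :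
    (Measure.pi fun _ : ι ↦ gaussianReal 0 v).real {x | ∑ i, x i ^ 2 ≤ v * s}
      ≤ Real.exp s * √(1 / 3) ^ Fintype.card ι := by
  have hv' : (0 : ℝ) < v := by positivity
  set P := Measure.pi fun _ : ι ↦ gaussianReal 0 v
  have hexp (x : ι → ℝ) :
      ∏ i, Real.exp (-(x i ^ 2 / v)) = Real.exp (-1 * ((∑ i, x i ^ 2) / v)) := by
    rw [← Real.exp_sum, Finset.sum_neg_distrib, ← Finset.sum_div, neg_one_mul]
  have hint : ∫ x, Real.exp (-1 * ((∑ i, x i ^ 2) / v)) ∂P = √(1 / 3) ^ Fintype.card ι := by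
    simp_rw [← hexp]
    rw [integral_fintype_prod_eq_pow fun x : ℝ ↦ Real.exp (-(x ^ 2 / v)),
      integral_exp_neg_sq_div_gaussianReal hv]
  have hset : {x : ι → ℝ | ∑ i, x i ^ 2 ≤ v * s} = {x | (∑ i, x i ^ 2) / v ≤ s} := by
    ext x
    simp only [Set.mem_ofPred_eq]
    rw [div_le_iff₀' hv']
  have hbound := measure_le_le_exp_mul_mgf (μ := P) (X := fun x : ι → ℝ ↦ (∑ i, x i ^ 2) / v)
    (t := -1) s (by norm_num) (Integrable.of_integral_ne_zero (by rw [hint]; positivity))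
  rw [mgf, hint, neg_neg, one_mul] at hbound
  rwa [hset]

/-- A linear form of i.i.d. centered Gaussian variables is sub-Gaussian. -/
theorem hasSubgaussianMGF_pi_gaussianReal_sum_mul {ι : Type*} [Fintype ι] (v : ℝ≥0) (w : ι → ℝ) :
    HasSubgaussianMGF (fun x : ι → ℝ ↦ ∑ i, w i * x i)
      (∑ i, ⟨w i ^ 2, sq_nonneg (w i)⟩ * v) (Measure.pi fun _ : ι ↦ gaussianReal 0 v) := by
  have hg : HasSubgaussianMGF (fun x : ℝ ↦ x) v (gaussianReal 0 v) :=
    ⟨integrable_exp_mul_gaussianReal, fun t ↦ by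
      rw [mgf_gaussianReal (μ := 0) (v := v) (by simp)]; simp⟩
  have hcoord (i : ι) : HasSubgaussianMGF (fun x : ι → ℝ ↦ x i) v
      (Measure.pi fun _ : ι ↦ gaussianReal 0 v) := by
    refine HasSubgaussianMGF.of_map (Y := fun x : ι → ℝ ↦ x i) (X := fun x : ℝ ↦ x)
      (measurable_pi_apply i).aemeasurable ?_
    rwa [(measurePreserving_eval (fun _ : ι ↦ gaussianReal 0 v) i).map_eq]
  exact HasSubgaussianMGF.sum_of_iIndepFun
    (iIndepFun_pi (X := fun i (x : ℝ) ↦ w i * x) fun i ↦ by fun_prop)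
    fun i _ ↦ (hcoord i).const_mul (w i)

theorem measureReal_pi_gaussianReal_le_abs_sum_mul {ι : Type*} [Fintype ι] (v : ℝ≥0)
    (w : ι → ℝ) {ε : ℝ} (hε : 0 ≤ ε) :
    (Measure.pi fun _ : ι ↦ gaussianReal 0 v).real {x | ε ≤ |∑ i, w i * x i|}
      ≤ 2 * Real.exp (-ε ^ 2 / (2 * (v * ∑ i, w i ^ 2))) := by
  have h := hasSubgaussianMGF_pi_gaussianReal_sum_mul v w
  have hc : ((∑ i, ⟨w i ^ 2, sq_nonneg (w i)⟩ * v : ℝ≥0) : ℝ) = v * ∑ i, w i ^ 2 := by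
    rw [NNReal.coe_sum, Finset.mul_sum]
    exact Finset.sum_congr rfl fun i _ ↦ mul_comm _ _
  have hpos := h.measure_ge_le hε
  have hneg := h.neg.measure_ge_le hε
  rw [hc] at hpos hneg
  have hset : {x : ι → ℝ | ε ≤ |∑ i, w i * x i|}
      = {x | ε ≤ ∑ i, w i * x i} ∪ {x | ε ≤ (-fun x : ι → ℝ ↦ ∑ i, w i * x i) x} := by
    ext x
    simp [le_abs]
  rw [hset, two_mul]
  exact (measureReal_union_le _ _).trans (add_le_add hpos hneg)

theorem exp_half_mul_sqrt_pow_le {k : ℕ} {x : ℝ} (hx : x ≤ (k : ℝ) / 2) :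
    Real.exp ((k : ℝ) / 2) * √(1 / 3) ^ (k + k) ≤ Real.exp (-x) := by
  have h3 : (1 / 3 : ℝ) ≤ Real.exp (-1) := by
    rw [Real.exp_neg, one_div]
    exact inv_anti₀ (Real.exp_pos 1) Real.exp_one_lt_three.le
  calc Real.exp ((k : ℝ) / 2) * √(1 / 3) ^ (k + k)
      = Real.exp ((k : ℝ) / 2) * (1 / 3) ^ k := by
        rw [← two_mul, pow_mul, Real.sq_sqrt (by norm_num)]
    _ ≤ Real.exp ((k : ℝ) / 2) * Real.exp (-1) ^ k := by gcongr
    _ = Real.exp (-((k : ℝ) / 2)) := by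
        rw [← Real.exp_nat_mul, ← Real.exp_add]
        congr 1
        ring
    _ ≤ Real.exp (-x) := by gcongr

/-- Fluctuation bound for a fixed nonzero linear form of a Gaussian vector. -/
theorem measureReal_pi_gaussianReal_linear_fluctuation_le {k : ℕ} (hk : 0 < k) {v : ℝ≥0}
    (hv : v ≠ 0) (w : Fin (k + k) → ℝ) (hw : 0 < ∑ i, w i ^ 2) {x : ℝ} (hx0 : 0 < x)
    (hxk : x ≤ (k : ℝ) / 2) :
    (Measure.pi fun _ : Fin (k + k) ↦ gaussianReal 0 v).real
        {a | 5 * √(x / k) * (∑ i, a i ^ 2 + ∑ i, w i ^ 2) ≤ |∑ i, w i * a i|}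
      ≤ 3 * Real.exp (-x) := by
  have hk' : (0 : ℝ) < k := by exact_mod_cast hk
  have hv' : (0 : ℝ) < v := by positivity
  set S := ∑ i, w i ^ 2
  set ε := 5 * √(x / k) * (v * (k / 2) + S) with hε
  have hsub : {a : Fin (k + k) → ℝ | 5 * √(x / k) * (∑ i, a i ^ 2 + S) ≤ |∑ i, w i * a i|}
      ⊆ {a | ∑ i, a i ^ 2 ≤ v * (k / 2)} ∪ {a | ε ≤ |∑ i, w i * a i|} := by
    intro a ha
    rcases le_total (∑ i, a i ^ 2) (v * (k / 2)) with h | h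
    · exact Or.inl h
    · refine Or.inr (show ε ≤ |∑ i, w i * a i| from le_trans ?_ ha)
      rw [hε]
      gcongr
  have hsmall := measureReal_pi_gaussianReal_sum_sq_le (ι := Fin (k + k)) hv (k / 2)
  rw [Fintype.card_fin] at hsmall
  replace hsmall := hsmall.trans (exp_half_mul_sqrt_pow_le hxk)
  have hlarge := measureReal_pi_gaussianReal_le_abs_sum_mul v w (ε := ε) (by positivity)
  have hexp : -ε ^ 2 / (2 * (v * S)) ≤ -x := by
    have hsq : ε ^ 2 = 25 * (x / k) * (v * (k / 2) + S) ^ 2 := by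
      rw [hε, mul_pow, mul_pow, Real.sq_sqrt (by positivity)]
      norm_num
    have hamgm : 2 * k * (v * S) ≤ (v * (k / 2) + S) ^ 2 := by
      nlinarith [sq_nonneg (v * (k / 2) - S)]
    rw [neg_div, neg_le_neg_iff, le_div_iff₀ (by positivity), hsq]
    calc x * (2 * (v * S)) ≤ 25 * (x * (2 * (v * S))) := by
          have : 0 ≤ x * (2 * (v * S)) := by positivity
          linarith
      _ = 25 * (x / k) * (2 * k * (v * S)) := by field_simp
      _ ≤ _ := by gcongr
  calc _ ≤ _ := measureReal_mono hsub
    _ ≤ _ := measureReal_union_le _ _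
    _ ≤ Real.exp (-x) + 2 * Real.exp (-x) := by
        refine add_le_add hsmall (hlarge.trans ?_)
        gcongr
    _ = 3 * Real.exp (-x) := by ring

/-- The vector obtained by changing the sign of the second half. -/
def negSecondHalf {k : ℕ} (y : Fin (k + k) → ℝ) : Fin (k + k) → ℝ :=
  Fin.append (firstHalf y) (-secondHalf y)

theorem sum_sq_negSecondHalf {k : ℕ} (y : Fin (k + k) → ℝ) :
    ∑ i, negSecondHalf y i ^ 2 = sqNorm y := by
  simp only [negSecondHalf, sqNorm, Fin.sum_univ_add, Fin.append_left, Fin.append_right, firstHalf,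
    secondHalf, Pi.neg_apply, neg_sq]

theorem sum_negSecondHalf_mul {k : ℕ} (a y : Fin (k + k) → ℝ) :
    ∑ i, negSecondHalf y i * a i
      = innerR (firstHalf a) (firstHalf y) - innerR (secondHalf a) (secondHalf y) := by
  simp only [negSecondHalf, innerR, Fin.sum_univ_add, Fin.append_left, Fin.append_right, firstHalf,
    secondHalf, Pi.neg_apply, mul_neg, Finset.sum_neg_distrib, sub_eq_add_neg, mul_comm]

theorem ae_pos_sqNorm_pi_gaussianReal {m : ℕ} [NeZero m] {v : ℝ≥0} (hv : v ≠ 0) :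
    ∀ᵐ y ∂Measure.pi fun _ : Fin m ↦ gaussianReal 0 v, 0 < sqNorm y := by
  have := nullSingletonClass_gaussianReal (μ := 0) hv
  filter_upwards [measure_eq_zero_iff_ae_notMem.1 (measure_singleton (μ := Measure.pi
    fun _ : Fin m ↦ gaussianReal 0 v) 0)] with y hy
  refine lt_of_le_of_ne (Finset.sum_nonneg fun i _ ↦ sq_nonneg _) fun h ↦ hy ?_
  have := (Finset.sum_eq_zero_iff_of_nonneg fun i _ ↦ sq_nonneg (y i)).1 h.symm
  exact funext fun i ↦ by simpa using this i (Finset.mem_univ i)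

/-- The set of pairs whose halves have inner products far apart relative to the squared norms. -/
def fluctuationSet (k : ℕ) (c : ℝ) : Set ((Fin (k + k) → ℝ) × (Fin (k + k) → ℝ)) :=
  {p | c * (sqNorm p.1 + sqNorm p.2)
    ≤ |innerR (firstHalf p.1) (firstHalf p.2) - innerR (secondHalf p.1) (secondHalf p.2)|}

theorem measurableSet_fluctuationSet (k : ℕ) (c : ℝ) : MeasurableSet (fluctuationSet k c) := by
  apply measurableSet_le
  · unfold sqNorm
    fun_prop
  · unfold innerR firstHalf secondHalf
    fun_prop

theorem prod_pi_gaussianReal_fluctuationSet_le {k : ℕ} (hk : 0 < k) {vX vY : ℝ≥0} (hvX : vX ≠ 0)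
    (hvY : vY ≠ 0) {x : ℝ} (hx0 : 0 < x) (hxk : x ≤ (k : ℝ) / 2) :
    ((Measure.pi fun _ : Fin (k + k) ↦ gaussianReal 0 vX).prod
        (Measure.pi fun _ : Fin (k + k) ↦ gaussianReal 0 vY)) (fluctuationSet k (5 * √(x / k)))
      ≤ ENNReal.ofReal (3 * Real.exp (-x)) := by
  have : NeZero (k + k) := ⟨by omega⟩
  set PX := Measure.pi fun _ : Fin (k + k) ↦ gaussianReal 0 vX
  set PY := Measure.pi fun _ : Fin (k + k) ↦ gaussianReal 0 vY
  rw [Measure.prod_apply_symm (measurableSet_fluctuationSet k _)]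
  calc _ ≤ ∫⁻ _, ENNReal.ofReal (3 * Real.exp (-x)) ∂PY := by
        refine lintegral_mono_ae ?_
        filter_upwards [ae_pos_sqNorm_pi_gaussianReal hvY] with y hy
        rw [← sum_sq_negSecondHalf] at hy
        have h := measureReal_pi_gaussianReal_linear_fluctuation_le hk hvX (negSecondHalf y) hy
          hx0 hxk
        simp_rw [sum_sq_negSecondHalf, sum_negSecondHalf_mul] at h
        rw [← ofReal_measureReal]
        exact ENNReal.ofReal_le_ofReal h
    _ = ENNReal.ofReal (3 * Real.exp (-x)) := by simp

/-- Fluctuation bound between the inner products of the two halves of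
independent Gaussian vectors in `ℝ^{2k}` (stated after Lemma 3 of the paper). -/
theorem inner_product_halves_fluctuation_bound
    {Ω : Type*} [MeasurableSpace Ω] (μ : Measure Ω) [IsProbabilityMeasure μ]
    (k : ℕ) (hk : 0 < k) (σX σY : ℝ) (hσX : 0 < σX ^ 2) (hσY : 0 < σY ^ 2)
    (X Y : Ω → (Fin (k + k) → ℝ))
    (hXmeas : Measurable X) (hYmeas : Measurable Y)
    (hindep : IndepFun X Y μ)
    (hXdist : Measure.map X μ = Measure.pi fun _ : Fin (k + k) => gaussianReal 0 ⟨σX ^ 2, hσX.le⟩)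
    (hYdist : Measure.map Y μ = Measure.pi fun _ : Fin (k + k) => gaussianReal 0 ⟨σY ^ 2, hσY.le⟩)
    (x : ℝ) (hx0 : 0 < x) (hxk : x ≤ (k : ℝ) / 2) :
    μ {ω | |innerR (firstHalf (X ω)) (firstHalf (Y ω))
            - innerR (secondHalf (X ω)) (secondHalf (Y ω))|
        ≥ 5 * Real.sqrt (x / k) * (sqNorm (X ω) + sqNorm (Y ω))}
      ≤ ENNReal.ofReal (8 * Real.exp (-x)) := by
  have hvX : (⟨σX ^ 2, hσX.le⟩ : ℝ≥0) ≠ 0 := fun h ↦ hσX.ne' (congrArg NNReal.toReal h)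
  have hvY : (⟨σY ^ 2, hσY.le⟩ : ℝ≥0) ≠ 0 := fun h ↦ hσY.ne' (congrArg NNReal.toReal h)
  have hjoint := hindep.map_prod_eq_prod_map_map hXmeas.aemeasurable hYmeas.aemeasurable
  calc μ ((fun ω ↦ (X ω, Y ω)) ⁻¹' fluctuationSet k (5 * √(x / k)))
      = ((μ.map X).prod (μ.map Y)) (fluctuationSet k (5 * √(x / k))) := by
        rw [← hjoint,
          Measure.map_apply (hXmeas.prodMk hYmeas) (measurableSet_fluctuationSet k _)]
    _ ≤ ENNReal.ofReal (3 * Real.exp (-x)) := by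
        rw [hXdist, hYdist]
        exact prod_pi_gaussianReal_fluctuationSet_le hk hvX hvY hx0 hxk
    _ ≤ ENNReal.ofReal (8 * Real.exp (-x)) := by
        gcongr
        norm_num
end

section
/- Let k > 0 and γ ≥ 0 be reals with exp(−kγ/8) ≤ 1/2. Then ∑_{ν=0}^∞ (γ + 2 + ν) exp(−k(γ + ν)²/16) ≤ 4(γ + 2) exp(−kγ²/16). -/
/-- Series bound from the proof of Theorem 1 (main parameter estimation):
for `k > 0`, `γ ≥ 0` with `exp(−kγ/8) ≤ 1/2`,
`∑_{ν=0}^∞ (γ + 2 + ν) exp(−k(γ + ν)²/16) ≤ 4(γ + 2) exp(−kγ²/16)`. -/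
theorem series_bound_parameter_estimation
    (k γ : ℝ) (hk : 0 < k) (hγ : 0 ≤ γ)
    (hq : Real.exp (-(k * γ) / 8) ≤ 1 / 2) :
    ∑' ν : ℕ, (γ + 2 + (ν : ℝ)) * Real.exp (-(k * (γ + (ν : ℝ)) ^ 2) / 16)
      ≤ 4 * (γ + 2) * Real.exp (-(k * γ ^ 2) / 16) := by
  set E := Real.exp (-(k * γ ^ 2) / 16)
  have hE : 0 < E := Real.exp_pos _
  have hexp (ν : ℕ) : Real.exp (-(k * (γ + (ν : ℝ)) ^ 2) / 16) ≤ E * (1 / 2) ^ ν := by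
    calc Real.exp (-(k * (γ + (ν : ℝ)) ^ 2) / 16)
        ≤ Real.exp (-(k * γ ^ 2) / 16 + ν * (-(k * γ) / 8)) := by
          apply Real.exp_le_exp.mpr
          nlinarith [mul_nonneg hk.le (sq_nonneg (ν : ℝ))]
      _ = E * Real.exp (-(k * γ) / 8) ^ ν := by rw [Real.exp_add, Real.exp_nat_mul]
      _ ≤ E * (1 / 2) ^ ν := by gcongr
  have hterm (ν : ℕ) : (γ + 2 + (ν : ℝ)) * Real.exp (-(k * (γ + (ν : ℝ)) ^ 2) / 16)
      ≤ E * ((γ + 2) * (1 / 2) ^ ν + ν * (1 / 2) ^ ν) := by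
    calc (γ + 2 + (ν : ℝ)) * Real.exp (-(k * (γ + (ν : ℝ)) ^ 2) / 16)
        ≤ (γ + 2 + (ν : ℝ)) * (E * (1 / 2) ^ ν) := by gcongr; exact hexp ν
      _ = E * ((γ + 2) * (1 / 2) ^ ν + ν * (1 / 2) ^ ν) := by ring
  have hsum : HasSum (fun ν : ℕ ↦ E * ((γ + 2) * (1 / 2) ^ ν + ν * (1 / 2) ^ ν))
      (E * ((γ + 2) * 2 + (1 / 2) / (1 - 1 / 2) ^ 2)) :=
    ((hasSum_geometric_two.mul_left (γ + 2)).add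
      (hasSum_coe_mul_geometric_of_norm_lt_one (by norm_num))).mul_left E
  have hsummable := Summable.of_nonneg_of_le (fun ν ↦ by positivity) hterm hsum.summable
  refine (hasSum_le hterm hsummable.hasSum hsum).trans ?_
  nlinarith [mul_nonneg hE.le hγ]
end

section
/- Let n ≥ 1 and η ∈ [0,1) be reals and let K be a real with K ≥ n/(1 − η). Then ((n−1)(n−2)²(n−3)/2) · ∫₀^η ∫₀^η (x − y)² / ((1 − x)⁴ (1 − y)⁴) dx dy ≤ K⁴/12. -/
/-- The inner integral, via the antiderivative `((1-x)/(1-y) - 1)³ / (3(1-x)⁵)` in `y`. -/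
theorem integral_sub_sq_div_pow_four_mul {η x : ℝ} (h1 : η < 1) (h0 : 0 ≤ η) (hx : x < 1) :
    (∫ y in (0 : ℝ)..η, (x - y) ^ 2 / ((1 - x) ^ 4 * (1 - y) ^ 4))
      = (((1 - η)⁻¹ - (1 - x)⁻¹) ^ 3 - (1 - (1 - x)⁻¹) ^ 3) / (3 * (1 - x) ^ 2) := by
  have hx' : 1 - x ≠ 0 := by linarith
  have hne : ∀ y ∈ Set.uIcc 0 η, 1 - y ≠ 0 := by
    intro y hy
    rw [Set.uIcc_of_le h0] at hy
    linarith [hy.2]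
  rw [intervalIntegral.integral_eq_sub_of_hasDerivAt
    (f := fun y => ((1 - y)⁻¹ - (1 - x)⁻¹) ^ 3 / (3 * (1 - x) ^ 2))]
  · simp only [sub_zero, inv_one]
    ring
  · intro y hy
    have hy' := hne y hy
    have hinv : HasDerivAt (fun y : ℝ => (1 - y)⁻¹) (1 / (1 - y) ^ 2) y := by
      simpa using ((hasDerivAt_id' y).const_sub 1).fun_inv hy'
    refine (((hinv.sub_const (1 - x)⁻¹).fun_pow 3).div_const (3 * (1 - x) ^ 2)).congr_deriv ?_
    norm_num only
    field_simp
    ring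
  · refine ContinuousOn.intervalIntegrable (ContinuousOn.div (by fun_prop) (by fun_prop) ?_)
    intro y hy
    have hy' := hne y hy
    positivity

/-- The double integral equals `((1-η)⁻¹ - 1)⁴ / 6`. -/
theorem integral_integral_sub_sq_div {η : ℝ} (h0 : 0 ≤ η) (h1 : η < 1) :
    (∫ x in (0 : ℝ)..η, ∫ y in (0 : ℝ)..η, (x - y) ^ 2 / ((1 - x) ^ 4 * (1 - y) ^ 4))
      = ((1 - η)⁻¹ - 1) ^ 4 / 6 := by
  have hlt : ∀ x ∈ Set.uIcc 0 η, x < 1 := by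
    intro x hx
    rw [Set.uIcc_of_le h0] at hx
    linarith [hx.2]
  have hne : ∀ x ∈ Set.uIcc 0 η, 1 - x ≠ 0 := fun x hx => by linarith [hlt x hx]
  rw [intervalIntegral.integral_congr
    fun x hx => integral_sub_sq_div_pow_four_mul h1 h0 (hlt x hx)]
  rw [intervalIntegral.integral_eq_sub_of_hasDerivAt
    (f := fun x => ((1 - (1 - x)⁻¹) ^ 4 - ((1 - η)⁻¹ - (1 - x)⁻¹) ^ 4) / 12)]
  · simp only [sub_zero, inv_one]
    ring
  · intro x hx
    have hx' := hne x hx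
    have hinv : HasDerivAt (fun x : ℝ => (1 - x)⁻¹) (1 / (1 - x) ^ 2) x := by
      simpa using ((hasDerivAt_id' x).const_sub 1).fun_inv hx'
    refine ((((hinv.const_sub 1).fun_pow 4).sub
      ((hinv.const_sub (1 - η)⁻¹).fun_pow 4)).div_const 12).congr_deriv ?_
    generalize (1 - η)⁻¹ = t
    norm_num only
    field_simp
    ring
  · have hinv : ContinuousOn (fun x : ℝ => (1 - x)⁻¹) (Set.uIcc 0 η) :=
      ContinuousOn.inv₀ (by fun_prop) hne
    refine ContinuousOn.intervalIntegrable (ContinuousOn.div (by fun_prop) (by fun_prop) ?_)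
    intro x hx
    have hx' := hne x hx
    positivity

/-- Theorem 5 of the paper: the trace `T(n,η)` of the cut-off Gaussian
de Finetti operator is at most `K⁴/12` whenever `K ≥ n/(1−η)`. -/
theorem deFinetti_trace_bound (n η K : ℝ) (hn : 1 ≤ n) (h0 : 0 ≤ η) (h1 : η < 1)
    (hK : n / (1 - η) ≤ K) :
    ((n - 1) * (n - 2) ^ 2 * (n - 3) / 2) *
      (∫ x in (0 : ℝ)..η, ∫ y in (0 : ℝ)..η,
        (x - y) ^ 2 / ((1 - x) ^ 4 * (1 - y) ^ 4))
      ≤ K ^ 4 / 12 := by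
  rw [integral_integral_sub_sq_div h0 h1]
  rw [div_eq_mul_inv] at hK
  have ht : 1 ≤ (1 - η)⁻¹ := (one_le_inv₀ (by linarith)).2 (by linarith)
  generalize (1 - η)⁻¹ = t at hK ht
  have hcoef : (n - 1) * (n - 2) ^ 2 * (n - 3) ≤ n ^ 4 := by
    have h : (n - 2) ^ 2 ≤ n ^ 2 := by nlinarith
    have h' : (n - 1) * (n - 3) ≤ n ^ 2 := by nlinarith
    calc (n - 1) * (n - 2) ^ 2 * (n - 3) = (n - 1) * (n - 3) * (n - 2) ^ 2 := by ring
      _ ≤ n ^ 2 * (n - 2) ^ 2 := by gcongr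
      _ ≤ n ^ 2 * n ^ 2 := by gcongr
      _ = n ^ 4 := by ring
  have ht0 : 0 ≤ t - 1 := by linarith
  calc (n - 1) * (n - 2) ^ 2 * (n - 3) / 2 * ((t - 1) ^ 4 / 6)
      ≤ n ^ 4 / 2 * (t ^ 4 / 6) := by gcongr; linarith
    _ = (n * t) ^ 4 / 12 := by ring
    _ ≤ K ^ 4 / 12 := by gcongr
end
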